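/- Let P be a homogeneous polynomial of degree d in n variables over ℂ and f(W, Re(V), Im(V)) = (1/2)‖Σ_{i=1}^r w_i (v_i^t x)^d − P‖_d^2 with W = (w_i) ∈ ℝ^r, V = [v_i] ∈ ℂ^{n×r}. The Hessian of f with respect to the real variables (W, Re(V), Im(V)) is the block matrix H^R = [[A, Re(B)^T, −Im(B)^T], [Re(B), Re(C+D), −Im(C+D)], [−Im(B), Im(D−C), Re(D−C)]] ∈ ℝ^{(r+2nr)×(r+2nr)}, where A = Re([(v_i^* v_j)^d]_{1≤i,j≤r}) ∈ ℝ^{r×r}; B = [d w_i (v_j^* v_i)^{d−1} v̄_j + δ_{i,j}(d Σ_{l=1}^r w_l (v_l^* v_i)^{d−1} v̄_l − ∇P̄(v_j))]_{1≤i,j≤r} ∈ ℂ^{nr×r}; C = diag[ d(d−1)[Σ_{i=1}^r w_i w_j conj(v_{i,k}) conj(v_{i,l}) (v_i^* v_j)^{d−2}]_{1≤k,l≤n} − w_j Δ P̄(v_j) ]_{1≤j≤r} ∈ ℂ^{nr×nr}; and D = [d w_i w_j (v_i^* v_j)^{d−2} ((v_i^* v_j) I_n + (d−1) v_j v_i^*)]_{1≤i,j≤r}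 ∈ ℂ^{nr×nr}. Here P̄ has the conjugated coefficients of P, ∇P̄ and ΔP̄ denote its gradient and Hessian matrix of second partial derivatives, and δ_{i,j} is the Kronecker delta. -/

import Mathlib

noncomputable section

open MvPolynomial Complex

/-- The apolar product `⟨P,Q⟩ = Σ_α conj(P_α) Q_α / C(d,α)`. -/
def apolar {n : ℕ} (P Q : MvPolynomial (Fin n) ℂ) : ℂ :=
  ∑ α ∈ P.support ∪ Q.support,
    starRingEnd ℂ (P.coeff α) * Q.coeff α / (Finsupp.multinomial α : ℂ)

/-- The `d`-th power of the linear form with coefficient vector `v`. -/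
def linPow {n : ℕ} (v : Fin n → ℂ) (d : ℕ) : MvPolynomial (Fin n) ℂ :=
  (∑ i, MvPolynomial.C (v i) * MvPolynomial.X i) ^ d

/-- The real domain: points `(W, Re V, Im V)`. -/
abbrev Dom (n r : ℕ) := (Fin r → ℝ) × (Fin r → Fin n → ℝ) × (Fin r → Fin n → ℝ)

/-- The complex vectors `vᵢ = Re(vᵢ) + i Im(vᵢ)` encoded by a point of the domain. -/
def vecOf {n r : ℕ} (p : Dom n r) : Fin r → Fin n → ℂ :=
  fun i j => (p.2.1 i j : ℂ) + (p.2.2 i j : ℂ) * Complex.I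

/-- The objective function `f = (1/2) ‖Σᵢ wᵢ (vᵢᵗ x)^d − P‖_d²`. -/
def objective {n r : ℕ} (d : ℕ) (P : MvPolynomial (Fin n) ℂ) (p : Dom n r) : ℝ :=
  (1 / 2) *
    (apolar ((∑ i, MvPolynomial.C ((p.1 i : ℂ)) * linPow (vecOf p i) d) - P)
      ((∑ i, MvPolynomial.C ((p.1 i : ℂ)) * linPow (vecOf p i) d) - P)).re

/-- Hermitian pairing `u^* w = Σ_l conj(u_l) w_l`. -/
def hdot {n : ℕ} (u w : Fin n → ℂ) : ℂ := ∑ l, starRingEnd ℂ (u l) * w l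

/-- Basis direction in the `W`-part. -/
def eW {n r : ℕ} (j : Fin r) : Dom n r := (Pi.single j 1, 0, 0)

/-- Basis direction in the `Re(V)`-part. -/
def eRe {n r : ℕ} (j : Fin r) (k : Fin n) : Dom n r := (0, Pi.single j (Pi.single k 1), 0)

/-- Basis direction in the `Im(V)`-part. -/
def eIm {n r : ℕ} (j : Fin r) (k : Fin n) : Dom n r := (0, 0, Pi.single j (Pi.single k 1))

/-- Second partial derivative of `f` at `p` in the directions `x`, `y`. -/
def D2 {n r : ℕ} (f : Dom n r → ℝ) (p x y : Dom n r) : ℝ :=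
  fderiv ℝ (fun q => fderiv ℝ f q y) p x

/-- `P̄`, the polynomial with conjugated coefficients. -/
def conjPoly {n : ℕ} (P : MvPolynomial (Fin n) ℂ) : MvPolynomial (Fin n) ℂ :=
  MvPolynomial.map (starRingEnd ℂ) P

/-- Entry `(i,·,k ; j)` of the block `B ∈ ℂ^{nr×r}`:
`B_{i,j} = d wᵢ (vⱼ^* vᵢ)^{d−1} v̄ⱼ + δ_{i,j}(d Σ_l w_l (v_l^* vᵢ)^{d−1} v̄_l − ∇P̄(vⱼ))`. -/
def Bent {n r : ℕ} (d : ℕ) (P : MvPolynomial (Fin n) ℂ) (p : Dom n r)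
    (i j : Fin r) (k : Fin n) : ℂ :=
  (d : ℂ) * (p.1 i : ℂ) * (hdot (vecOf p j) (vecOf p i)) ^ (d - 1) *
      starRingEnd ℂ (vecOf p j k) +
    (if i = j then
      ((d : ℂ) * ∑ l, (p.1 l : ℂ) * (hdot (vecOf p l) (vecOf p i)) ^ (d - 1) *
          starRingEnd ℂ (vecOf p l k)) -
        MvPolynomial.eval (vecOf p j) (MvPolynomial.pderiv k (conjPoly P))
    else 0)

/-- Entry `((i,k),(j,l))` of the block-diagonal matrix
`C = diag_j (d(d−1)[Σ_m w_m w_j v̄_{m,k} v̄_{m,l} (v_m^* v_j)^{d−2}]_{k,l} − w_j ΔP̄(v_j))`. -/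
def Cent {n r : ℕ} (d : ℕ) (P : MvPolynomial (Fin n) ℂ) (p : Dom n r)
    (i : Fin r) (k : Fin n) (j : Fin r) (l : Fin n) : ℂ :=
  if i = j then
    (d : ℂ) * ((d : ℂ) - 1) *
        (∑ m, (p.1 m : ℂ) * (p.1 j : ℂ) * starRingEnd ℂ (vecOf p m k) *
          starRingEnd ℂ (vecOf p m l) * (hdot (vecOf p m) (vecOf p j)) ^ (d - 2)) -
      (p.1 j : ℂ) *
        MvPolynomial.eval (vecOf p j)
          (MvPolynomial.pderiv k (MvPolynomial.pderiv l (conjPoly P)))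
  else 0

/-- Entry `((i,k),(j,l))` of the block matrix
`D = [d wᵢ wⱼ (vᵢ^* vⱼ)^{d−2}((vᵢ^* vⱼ) I_n + (d−1) vⱼ vᵢ^*)]_{i,j}`. -/
def Dent {n r : ℕ} (d : ℕ) (p : Dom n r)
    (i : Fin r) (k : Fin n) (j : Fin r) (l : Fin n) : ℂ :=
  (d : ℂ) * (p.1 i : ℂ) * (p.1 j : ℂ) * (hdot (vecOf p i) (vecOf p j)) ^ (d - 2) *
    ((hdot (vecOf p i) (vecOf p j)) * (if k = l then 1 else 0) +
      ((d : ℂ) - 1) * vecOf p j k * starRingEnd ℂ (vecOf p i l))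

theorem apolar_eq_sum_left {n : ℕ} (P Q : MvPolynomial (Fin n) ℂ) :
    apolar P Q = ∑ α ∈ P.support,
      starRingEnd ℂ (P.coeff α) * Q.coeff α / (Finsupp.multinomial α : ℂ) := by
  refine (Finset.sum_subset Finset.subset_union_left fun α _ hα => ?_).symm
  simp [notMem_support_iff.mp hα]

theorem apolar_conj_symm {n : ℕ} (P Q : MvPolynomial (Fin n) ℂ) :
    starRingEnd ℂ (apolar P Q) = apolar Q P := by
  simp only [apolar, map_sum, Finset.union_comm Q.support, map_div₀, map_mul, conj_conj,
    map_natCast, mul_comm]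

theorem isLinearMap_apolar {n : ℕ} (P : MvPolynomial (Fin n) ℂ) :
    IsLinearMap ℂ (apolar P) where
  map_add Q R := by
    simp only [apolar_eq_sum_left, coeff_add, mul_add, add_div, Finset.sum_add_distrib]
  map_smul c Q := by
    simp only [apolar_eq_sum_left, coeff_smul, smul_eq_mul, Finset.mul_sum]
    exact Finset.sum_congr rfl fun _ _ => by ring

theorem apolar_sub_right {n : ℕ} (P Q R : MvPolynomial (Fin n) ℂ) :
    apolar P (Q - R) = apolar P Q - apolar P R :=
  (isLinearMap_apolar P).map_sub Q R

theorem apolar_sub_left {n : ℕ} (P Q R : MvPolynomial (Fin n) ℂ) :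
    apolar (P - Q) R = apolar P R - apolar Q R := by
  rw [← apolar_conj_symm, apolar_sub_right, map_sub, apolar_conj_symm, apolar_conj_symm]

theorem apolar_sum_C_mul_right {n r : ℕ} (P : MvPolynomial (Fin n) ℂ) (w : Fin r → ℂ)
    (L : Fin r → MvPolynomial (Fin n) ℂ) :
    apolar P (∑ i, C (w i) * L i) = ∑ i, w i * apolar P (L i) := by
  have h := map_sum (isLinearMap_apolar P).mk' (fun i => C (w i) * L i) Finset.univ
  simpa only [C_mul', IsLinearMap.mk'_apply, (isLinearMap_apolar P).map_smul, smul_eq_mul] using h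

theorem coeff_linPow {n : ℕ} (v : Fin n → ℂ) (d : ℕ) (α : Fin n →₀ ℕ) :
    (linPow v d).coeff α =
      if α.degree = d then (α.multinomial : ℂ) * ∏ i, v i ^ α i else 0 := by
  simp only [linPow, C_mul', coeff_linearCombination_X_pow_of_fintype, Finsupp.degree_apply,
    Finsupp.sum, Finsupp.prod_fintype, pow_zero, implies_true]
  congr

theorem multinomial_ne_zero {n : ℕ} (α : Fin n →₀ ℕ) : (α.multinomial : ℂ) ≠ 0 := by
  rw [Finsupp.multinomial_eq]
  exact_mod_cast (Nat.multinomial_pos _ _).ne'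

/-- The reproducing property of the apolar product. -/
theorem apolar_linPow_right {n d : ℕ} {P : MvPolynomial (Fin n) ℂ} (hP : P.IsHomogeneous d)
    (v : Fin n → ℂ) : apolar P (linPow v d) = eval v (conjPoly P) := by
  have hsupp : (conjPoly P).support = P.support :=
    support_map_of_injective _ (starRingEnd ℂ).injective
  rw [apolar_eq_sum_left, eval_eq', hsupp]
  refine Finset.sum_congr rfl fun α hα => ?_
  have hα : α.degree = d :=
    (hP.degree_eq_sum_deg_support hα).symm
  have := multinomial_ne_zero α
  rw [coeff_linPow, if_pos hα, conjPoly, coeff_map]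
  field_simp

theorem isHomogeneous_linPow {n : ℕ} (v : Fin n → ℂ) (d : ℕ) :
    (linPow v d).IsHomogeneous d := by
  have h : (∑ i, C (v i) * X i : MvPolynomial (Fin n) ℂ).IsHomogeneous 1 :=
    IsHomogeneous.sum _ _ _ fun i _ => isHomogeneous_C_mul_X _ _
  simpa [linPow] using h.pow d

theorem eval_conjPoly_linPow {n : ℕ} (u v : Fin n → ℂ) (d : ℕ) :
    eval v (conjPoly (linPow u d)) = hdot u v ^ d := by
  simp [conjPoly, linPow, hdot]

/-- The objective function as a polynomial expression in the weights and the vectors. -/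
theorem objective_eq {n r d : ℕ} {P : MvPolynomial (Fin n) ℂ} (hP : P.IsHomogeneous d)
    (p : Dom n r) :
    objective d P p =
      (1 / 2 * ∑ i, ∑ j, (p.1 i : ℂ) * (p.1 j : ℂ) * hdot (vecOf p i) (vecOf p j) ^ d -
        ∑ i, (p.1 i : ℂ) * eval (vecOf p i) (conjPoly P) + 1 / 2 * apolar P P).re := by
  set T := ∑ i, C ((p.1 i : ℂ)) * linPow (vecOf p i) d with hT
  have hPT : apolar P T = ∑ i, (p.1 i : ℂ) * eval (vecOf p i) (conjPoly P) := by
    simp only [hT, apolar_sum_C_mul_right, apolar_linPow_right hP]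
  have hTT : apolar T T =
      ∑ i, ∑ j, (p.1 i : ℂ) * (p.1 j : ℂ) * hdot (vecOf p i) (vecOf p j) ^ d := by
    have hL (i) : apolar T (linPow (vecOf p i) d) =
        ∑ j, (p.1 j : ℂ) * hdot (vecOf p j) (vecOf p i) ^ d := by
      rw [← apolar_conj_symm, hT, apolar_sum_C_mul_right, map_sum]
      refine Finset.sum_congr rfl fun j _ => ?_
      rw [map_mul, apolar_conj_symm, apolar_linPow_right (isHomogeneous_linPow _ _),
        eval_conjPoly_linPow, conj_ofReal]
    rw [hT, apolar_sum_C_mul_right, ← hT, Finset.sum_comm]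
    simp only [hL, Finset.mul_sum]
    exact Finset.sum_congr rfl fun i _ => Finset.sum_congr rfl fun j _ => by ring
  have hTP : (apolar T P).re = (apolar P T).re := by rw [← apolar_conj_symm, conj_re]
  rw [objective, ← hT, apolar_sub_left, apolar_sub_right, apolar_sub_right, ← hPT, ← hTT]
  have half (z : ℂ) : ((1 / 2 : ℂ) * z).re = 1 / 2 * z.re := by simp
  simp only [sub_re, add_re, half, hTP]
  ring

section Calculus

variable {n r : ℕ}

@[fun_prop]
theorem differentiable_vecOf (i : Fin r) (k : Fin n) :
    Differentiable ℝ fun q : Dom n r => vecOf q i k := by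
  unfold vecOf
  have h (g : Dom n r → ℝ) (hg : Differentiable ℝ g) : Differentiable ℝ fun q => (g q : ℂ) :=
    ofRealCLM.differentiable.comp hg
  exact (h _ (by fun_prop)).add ((h _ (by fun_prop)).mul_const _)

@[fun_prop]
theorem differentiable_conj_vecOf (i : Fin r) (k : Fin n) :
    Differentiable ℝ fun q : Dom n r => starRingEnd ℂ (vecOf q i k) :=
  (differentiable_vecOf i k).star

@[fun_prop]
theorem differentiable_weight (i : Fin r) :
    Differentiable ℝ fun q : Dom n r => (q.1 i : ℂ) :=
  ofRealCLM.differentiable.comp (by fun_prop : Differentiable ℝ fun q : Dom n r => q.1 i)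

@[fun_prop]
theorem differentiable_hdot_vecOf (i j : Fin r) :
    Differentiable ℝ fun q : Dom n r => hdot (vecOf q i) (vecOf q j) := by
  unfold hdot
  fun_prop

@[fun_prop]
theorem differentiable_eval_vecOf (Q : MvPolynomial (Fin n) ℂ) (i : Fin r) :
    Differentiable ℝ fun q : Dom n r => eval (vecOf q i) Q := by
  simp only [eval_eq']
  fun_prop

theorem vecOf_add_smul (q y : Dom n r) (t : ℝ) (i : Fin r) (k : Fin n) :
    vecOf (q + t • y) i k = vecOf q i k + t * vecOf y i k := by
  simp only [vecOf, Prod.snd_add, Prod.fst_add, Prod.smul_snd, Prod.smul_fst, Pi.add_apply,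
    Pi.smul_apply, smul_eq_mul, ofReal_add, ofReal_mul]
  ring

theorem hasDerivAt_vecOf (q y : Dom n r) (i : Fin r) (k : Fin n) :
    HasDerivAt (fun t : ℝ => vecOf (q + t • y) i k) (vecOf y i k) 0 := by
  simp only [vecOf_add_smul]
  simpa using ((hasDerivAt_id (0 : ℝ)).ofReal_comp.mul_const (vecOf y i k)).const_add
    (vecOf q i k)

theorem hasDerivAt_conj_vecOf (q y : Dom n r) (i : Fin r) (k : Fin n) :
    HasDerivAt (fun t : ℝ => starRingEnd ℂ (vecOf (q + t • y) i k))
      (starRingEnd ℂ (vecOf y i k)) 0 :=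
  (hasDerivAt_vecOf q y i k).star

theorem hasDerivAt_weight (q y : Dom n r) (i : Fin r) :
    HasDerivAt (fun t : ℝ => ((q + t • y).1 i : ℂ)) (y.1 i : ℂ) 0 := by
  simpa using ((hasDerivAt_id (0 : ℝ)).ofReal_comp.mul_const (y.1 i : ℂ)).const_add (q.1 i : ℂ)

theorem hasDerivAt_hdot_pow (q y : Dom n r) (i j : Fin r) (m : ℕ) :
    HasDerivAt (fun t : ℝ => hdot (vecOf (q + t • y) i) (vecOf (q + t • y) j) ^ m)
      (m * hdot (vecOf q i) (vecOf q j) ^ (m - 1) *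
        (hdot (vecOf y i) (vecOf q j) + hdot (vecOf q i) (vecOf y j))) 0 := by
  have h : HasDerivAt (fun t : ℝ => hdot (vecOf (q + t • y) i) (vecOf (q + t • y) j))
      (hdot (vecOf y i) (vecOf q j) + hdot (vecOf q i) (vecOf y j)) 0 := by
    have := HasDerivAt.fun_sum fun k (_ : k ∈ Finset.univ) =>
      (hasDerivAt_conj_vecOf q y i k).mul (hasDerivAt_vecOf q y j k)
    simpa [hdot, Finset.sum_add_distrib] using this
  simpa using h.fun_pow m

theorem hasDerivAt_eval_vecOf (Q : MvPolynomial (Fin n) ℂ) (q y : Dom n r) (i : Fin r) :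
    HasDerivAt (fun t : ℝ => eval (vecOf (q + t • y) i) Q)
      (∑ k, eval (vecOf q i) (pderiv k Q) * vecOf y i k) 0 := by
  induction Q using MvPolynomial.induction_on with
  | C a => simpa using hasDerivAt_const (0 : ℝ) a
  | add P Q hP hQ => simpa [add_mul, Finset.sum_add_distrib] using hP.fun_add hQ
  | mul_X Q k hQ =>
    simp only [map_mul, eval_X]
    convert! hQ.mul (hasDerivAt_vecOf q y i k) using 1
    simp only [Derivation.leibniz, pderiv_X, smul_eq_mul, map_add, map_mul, eval_X, add_mul,
      Finset.sum_add_distrib, zero_smul, add_zero, Finset.sum_mul]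
    rw [add_comm]
    congr 1
    · exact Finset.sum_congr rfl fun _ _ => by ring
    · simp [Pi.single_apply, apply_ite (eval (vecOf q i))]

theorem fderiv_apply_eq_of_hasDerivAt {E F : Type*} [NormedAddCommGroup E] [NormedSpace ℝ E]
    [NormedAddCommGroup F] [NormedSpace ℝ F] {f : E → F} {q y : E} {c : F}
    (hf : Differentiable ℝ f) (h : HasDerivAt (fun t : ℝ => f (q + t • y)) c 0) :
    fderiv ℝ f q y = c := by
  rw [← (hf q).lineDeriv_eq_fderiv]
  exact HasLineDerivAt.lineDeriv h

theorem fderiv_re_apply {E : Type*} [NormedAddCommGroup E] [NormedSpace ℝ E] {f : E → ℂ}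
    {q y : E} {c : ℂ} (hf : Differentiable ℝ f)
    (h : HasDerivAt (fun t : ℝ => f (q + t • y)) c 0) :
    fderiv ℝ (fun x => (f x).re) q y = c.re :=
  fderiv_apply_eq_of_hasDerivAt (reCLM.differentiable.comp hf)
    (reCLM.hasFDerivAt.comp_hasDerivAt (0 : ℝ) h)

theorem fderiv_neg_im_apply {E : Type*} [NormedAddCommGroup E] [NormedSpace ℝ E] {f : E → ℂ}
    {q y : E} {c : ℂ} (hf : Differentiable ℝ f)
    (h : HasDerivAt (fun t : ℝ => f (q + t • y)) c 0) :
    fderiv ℝ (fun x => -(f x).im) q y = -c.im :=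
  fderiv_apply_eq_of_hasDerivAt (imCLM.differentiable.comp hf).neg
    (imCLM.hasFDerivAt.comp_hasDerivAt (0 : ℝ) h).neg

/-- The complex function whose real part is `∂f/∂w_j`. -/
def gradW (d : ℕ) (P : MvPolynomial (Fin n) ℂ) (j : Fin r) (q : Dom n r) : ℂ :=
  ∑ i, (q.1 i : ℂ) * hdot (vecOf q i) (vecOf q j) ^ d - eval (vecOf q j) (conjPoly P)

/-- The complex function whose real part is `∂f/∂Re(v_{j,l})` and whose negated imaginary part is
`∂f/∂Im(v_{j,l})`. -/
def gradV (d : ℕ) (P : MvPolynomial (Fin n) ℂ) (j : Fin r) (l : Fin n) (q : Dom n r) : ℂ :=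
  (q.1 j : ℂ) * (d * ∑ i, (q.1 i : ℂ) * hdot (vecOf q i) (vecOf q j) ^ (d - 1) *
    starRingEnd ℂ (vecOf q i l) - eval (vecOf q j) (pderiv l (conjPoly P)))

theorem differentiable_gradW (d : ℕ) (P : MvPolynomial (Fin n) ℂ) (j : Fin r) :
    Differentiable ℝ (gradW d P j) := by
  unfold gradW
  fun_prop

theorem differentiable_gradV (d : ℕ) (P : MvPolynomial (Fin n) ℂ) (j : Fin r) (l : Fin n) :
    Differentiable ℝ (gradV d P j l) := by
  unfold gradV
  fun_prop

theorem hasDerivAt_gradW (d : ℕ) (P : MvPolynomial (Fin n) ℂ) (j : Fin r) (q x : Dom n r) :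
    HasDerivAt (fun t : ℝ => gradW d P j (q + t • x))
      (∑ i, ((x.1 i : ℂ) * hdot (vecOf q i) (vecOf q j) ^ d +
          (q.1 i : ℂ) * (d * hdot (vecOf q i) (vecOf q j) ^ (d - 1) *
            (hdot (vecOf x i) (vecOf q j) + hdot (vecOf q i) (vecOf x j)))) -
        ∑ k, eval (vecOf q j) (pderiv k (conjPoly P)) * vecOf x j k) 0 := by
  have := (HasDerivAt.fun_sum fun i (_ : i ∈ Finset.univ) =>
    (hasDerivAt_weight q x i).fun_mul (hasDerivAt_hdot_pow q x i j d)).fun_sub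
      (hasDerivAt_eval_vecOf (conjPoly P) q x j)
  simp only [zero_smul, add_zero] at this
  exact this

theorem hasDerivAt_gradV (d : ℕ) (P : MvPolynomial (Fin n) ℂ) (j : Fin r) (l : Fin n)
    (q x : Dom n r) :
    HasDerivAt (fun t : ℝ => gradV d P j l (q + t • x))
      ((x.1 j : ℂ) * (d * ∑ i, (q.1 i : ℂ) * hdot (vecOf q i) (vecOf q j) ^ (d - 1) *
          starRingEnd ℂ (vecOf q i l) - eval (vecOf q j) (pderiv l (conjPoly P))) +
        (q.1 j : ℂ) * (d * ∑ i, (((x.1 i : ℂ) * hdot (vecOf q i) (vecOf q j) ^ (d - 1) +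
            (q.1 i : ℂ) * (((d - 1 : ℕ) : ℂ) * hdot (vecOf q i) (vecOf q j) ^ (d - 1 - 1) *
              (hdot (vecOf x i) (vecOf q j) + hdot (vecOf q i) (vecOf x j)))) *
              starRingEnd ℂ (vecOf q i l) +
            (q.1 i : ℂ) * hdot (vecOf q i) (vecOf q j) ^ (d - 1) *
              starRingEnd ℂ (vecOf x i l)) -
          ∑ k, eval (vecOf q j) (pderiv k (pderiv l (conjPoly P))) * vecOf x j k)) 0 := by
  have := (hasDerivAt_weight q x j).fun_mul (((HasDerivAt.fun_sum fun i (_ : i ∈ Finset.univ) =>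
    ((hasDerivAt_weight q x i).fun_mul (hasDerivAt_hdot_pow q x i j (d - 1))).fun_mul
      (hasDerivAt_conj_vecOf q x i l)).const_mul (d : ℂ)).fun_sub
        (hasDerivAt_eval_vecOf (pderiv l (conjPoly P)) q x j))
  simp only [zero_smul, add_zero] at this
  exact this

theorem hdot_conj_symm (u v : Fin n → ℂ) : starRingEnd ℂ (hdot u v) = hdot v u := by
  simp only [hdot, map_sum, map_mul, conj_conj, mul_comm]

theorem fderiv_objective {d : ℕ} {P : MvPolynomial (Fin n) ℂ} (hP : P.IsHomogeneous d)
    (q y : Dom n r) :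
    fderiv ℝ (objective d P) q y =
      (∑ j, (y.1 j : ℂ) * gradW d P j q + ∑ j, ∑ l, vecOf y j l * gradV d P j l q).re := by
  rw [funext fun q => objective_eq (r := r) hP q]
  have h := (((HasDerivAt.fun_sum fun i (_ : i ∈ Finset.univ) =>
    HasDerivAt.fun_sum fun j (_ : j ∈ Finset.univ) =>
      ((hasDerivAt_weight q y i).fun_mul (hasDerivAt_weight q y j)).fun_mul
        (hasDerivAt_hdot_pow q y i j d)).const_mul (1 / 2 : ℂ)).fun_sub
    (HasDerivAt.fun_sum fun i (_ : i ∈ Finset.univ) =>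
      (hasDerivAt_weight q y i).fun_mul (hasDerivAt_eval_vecOf (conjPoly P) q y i))).add_const
    (1 / 2 * apolar P P)
  rw [fderiv_re_apply (by fun_prop) h]
  simp only [zero_smul, add_zero]
  set S₁ := ∑ j, ∑ i, (y.1 j : ℂ) * q.1 i * hdot (vecOf q i) (vecOf q j) ^ d with hS₁
  set S₂ := ∑ j, ∑ i, (q.1 i : ℂ) * q.1 j * (d * hdot (vecOf q i) (vecOf q j) ^ (d - 1) *
    hdot (vecOf q i) (vecOf y j)) with hS₂
  have hc₁ : starRingEnd ℂ S₁ =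
      ∑ i, ∑ j, (y.1 i : ℂ) * q.1 j * hdot (vecOf q i) (vecOf q j) ^ d := by
    simp only [hS₁, map_sum, map_mul, map_pow, hdot_conj_symm, conj_ofReal]
  have hc₂ : starRingEnd ℂ S₂ = ∑ i, ∑ j, (q.1 i : ℂ) * q.1 j *
      (d * hdot (vecOf q i) (vecOf q j) ^ (d - 1) * hdot (vecOf y i) (vecOf q j)) := by
    simp only [hS₂, map_sum, map_mul, map_pow, hdot_conj_symm, conj_ofReal, map_natCast]
    exact Finset.sum_congr rfl fun _ _ => Finset.sum_congr rfl fun _ _ => by ring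
  have hL : ∑ i, ∑ j, (((y.1 i : ℂ) * q.1 j + q.1 i * y.1 j) *
        hdot (vecOf q i) (vecOf q j) ^ d + (q.1 i : ℂ) * q.1 j *
        (d * hdot (vecOf q i) (vecOf q j) ^ (d - 1) *
          (hdot (vecOf y i) (vecOf q j) + hdot (vecOf q i) (vecOf y j)))) =
      S₁ + starRingEnd ℂ S₁ + (S₂ + starRingEnd ℂ S₂) := by
    rw [hc₁, hc₂, hS₁, hS₂, Finset.sum_comm (f := fun j i => (y.1 j : ℂ) * q.1 i * _),
      Finset.sum_comm (f := fun j i => (q.1 i : ℂ) * q.1 j * _)]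
    simp only [← Finset.sum_add_distrib]
    exact Finset.sum_congr rfl fun _ _ => Finset.sum_congr rfl fun _ _ => by ring
  have hR₁ : ∑ j, (y.1 j : ℂ) * gradW d P j q =
      S₁ - ∑ i, (y.1 i : ℂ) * eval (vecOf q i) (conjPoly P) := by
    rw [hS₁, ← Finset.sum_sub_distrib]
    simp only [gradW, mul_sub, Finset.mul_sum, mul_assoc]
  have hR₂ : ∑ j, ∑ l, vecOf y j l * gradV d P j l q =
      S₂ - ∑ j, (q.1 j : ℂ) * ∑ k, eval (vecOf q j) (pderiv k (conjPoly P)) * vecOf y j k := by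
    rw [hS₂, ← Finset.sum_sub_distrib]
    refine Finset.sum_congr rfl fun j _ => ?_
    simp only [gradV, hdot, mul_sub, Finset.mul_sum, Finset.sum_sub_distrib]
    rw [Finset.sum_comm]
    congr 1
    · exact Finset.sum_congr rfl fun _ _ => Finset.sum_congr rfl fun _ _ => by ring
    · exact Finset.sum_congr rfl fun _ _ => by ring
  rw [hL, hR₁, hR₂]
  simp only [Finset.sum_add_distrib, sub_re, add_re]
  have half (z : ℂ) : ((1 / 2 : ℂ) * z).re = 1 / 2 * z.re := by simp
  simp only [half, add_re, conj_re]
  ring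

theorem vecOf_eW (j : Fin r) : vecOf (eW j : Dom n r) = 0 := by
  ext i k
  simp [vecOf, eW]

theorem vecOf_eRe (j : Fin r) (l : Fin n) : vecOf (eRe j l) = Pi.single j (Pi.single l 1) := by
  ext i k
  by_cases h : i = j <;> by_cases h' : k = l <;> simp [vecOf, eRe, h, h']

theorem vecOf_eIm (j : Fin r) (l : Fin n) : vecOf (eIm j l) = Pi.single j (Pi.single l I) := by
  ext i k
  by_cases h : i = j <;> by_cases h' : k = l <;> simp [vecOf, eIm, h, h']

theorem eW_fst (i j : Fin r) : (eW j : Dom n r).1 i = if i = j then 1 else 0 :=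
  Pi.single_apply _ _ _

theorem hdot_zero_left (u : Fin n → ℂ) : hdot 0 u = 0 := by simp [hdot]

theorem hdot_zero_right (u : Fin n → ℂ) : hdot u 0 = 0 := by simp [hdot]

theorem hdot_single_left (i m : Fin r) (k : Fin n) (c : ℂ) (u : Fin n → ℂ) :
    hdot ((Pi.single i (Pi.single k c) : Fin r → Fin n → ℂ) m) u =
      if m = i then starRingEnd ℂ c * u k else 0 := by
  by_cases h : m = i
  · subst h
    simp [hdot, Pi.single_apply, apply_ite (starRingEnd ℂ)]
  · simp [hdot, h]

theorem hdot_single_right (i m : Fin r) (k : Fin n) (c : ℂ) (u : Fin n → ℂ) :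
    hdot u ((Pi.single i (Pi.single k c) : Fin r → Fin n → ℂ) m) =
      if m = i then c * starRingEnd ℂ (u k) else 0 := by
  rw [← hdot_conj_symm, hdot_single_left]
  split_ifs <;> simp

theorem sum_mul_single_single (i j : Fin r) (k : Fin n) (c : ℂ) (g : Fin n → ℂ) :
    ∑ m, g m * (Pi.single i (Pi.single k c) : Fin r → Fin n → ℂ) j m =
      if i = j then g k * c else 0 := by
  by_cases h : i = j
  · subst h
    simp [Pi.single_apply]
  · simp [h]

section PartialDerivatives

variable {d : ℕ} {P : MvPolynomial (Fin n) ℂ}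

theorem fderiv_objective_eW (hP : P.IsHomogeneous d) (q : Dom n r) (j : Fin r) :
    fderiv ℝ (objective d P) q (eW j) = (gradW d P j q).re := by
  rw [fderiv_objective hP, vecOf_eW]
  simp [eW, Pi.single_apply, apply_ite ofReal]

theorem sum_single_single_mul (j : Fin r) (l : Fin n) (c : ℂ) (g : Fin r → Fin n → ℂ) :
    ∑ i, ∑ k, (Pi.single j (Pi.single l c) : Fin r → Fin n → ℂ) i k * g i k = c * g j l := by
  simp only [mul_comm _ (g _ _), sum_mul_single_single, Finset.sum_ite_eq, Finset.mem_univ,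
    if_true]

theorem fderiv_objective_eRe (hP : P.IsHomogeneous d) (q : Dom n r) (j : Fin r) (l : Fin n) :
    fderiv ℝ (objective d P) q (eRe j l) = (gradV d P j l q).re := by
  rw [fderiv_objective hP, vecOf_eRe, sum_single_single_mul]
  simp [eRe]

theorem fderiv_objective_eIm (hP : P.IsHomogeneous d) (q : Dom n r) (j : Fin r) (l : Fin n) :
    fderiv ℝ (objective d P) q (eIm j l) = -(gradV d P j l q).im := by
  rw [fderiv_objective hP, vecOf_eIm, sum_single_single_mul]
  simp [eIm]

theorem hasDerivAt_gradW_eW (p : Dom n r) (i j : Fin r) :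
    HasDerivAt (fun t : ℝ => gradW d P j (p + t • eW i))
      (hdot (vecOf p i) (vecOf p j) ^ d) 0 := by
  convert! hasDerivAt_gradW d P j p (eW i) using 1
  simp [vecOf_eW, hdot_zero_left, hdot_zero_right, eW_fst, apply_ite ofReal]

theorem hasDerivAt_gradW_single (p x : Dom n r) (i j : Fin r) (k : Fin n) (c : ℂ)
    (hx : x.1 = 0) (hv : vecOf x = Pi.single i (Pi.single k c)) :
    HasDerivAt (fun t : ℝ => gradW d P j (p + t • x))
      (starRingEnd ℂ c * (d * p.1 i * hdot (vecOf p i) (vecOf p j) ^ (d - 1) * vecOf p j k) +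
        c * if i = j then
          d * ∑ l, (p.1 l : ℂ) * hdot (vecOf p l) (vecOf p i) ^ (d - 1) *
            starRingEnd ℂ (vecOf p l k) - eval (vecOf p j) (pderiv k (conjPoly P))
        else 0) 0 := by
  convert! hasDerivAt_gradW d P j p x using 1
  simp only [hx, hv, hdot_single_left, hdot_single_right, sum_mul_single_single, Pi.zero_apply,
    ofReal_zero, zero_mul, zero_add, mul_add, mul_ite, mul_zero, Finset.sum_add_distrib,
    Finset.sum_ite_eq', Finset.mem_univ, if_true]
  by_cases h : i = j
  · subst h
    simp only [if_true, mul_sub, Finset.mul_sum, add_sub_assoc]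
    congr 1
    · ring
    · congr 1
      · exact Finset.sum_congr rfl fun _ _ => by ring
      · ring
  · simp only [h, Ne.symm h, if_false, Finset.sum_const_zero]
    ring

theorem hasDerivAt_gradV_eW (p : Dom n r) (i j : Fin r) (k : Fin n) :
    HasDerivAt (fun t : ℝ => gradV d P i k (p + t • eW j)) (Bent d P p i j k) 0 := by
  convert! hasDerivAt_gradV d P i k p (eW j) using 1
  simp only [vecOf_eW, hdot_zero_left, hdot_zero_right, eW_fst, apply_ite ofReal, Pi.zero_apply,
    map_zero, zero_mul, mul_zero, Finset.sum_const_zero, add_zero, ofReal_one, ofReal_zero, ite_mul,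
    one_mul, Finset.sum_ite_eq', Finset.mem_univ, if_true, sub_zero]
  rw [Bent, add_comm]
  by_cases h : i = j
  · subst h
    simp only [if_true]
    ring
  · simp only [h, if_false]
    ring

theorem hasDerivAt_gradV_single (hd : 2 ≤ d) (p x : Dom n r) (i j : Fin r) (k l : Fin n) (c : ℂ)
    (hx : x.1 = 0) (hv : vecOf x = Pi.single i (Pi.single k c)) :
    HasDerivAt (fun t : ℝ => gradV d P j l (p + t • x))
      (starRingEnd ℂ c * Dent d p i k j l + c * Cent d P p i k j l) 0 := by
  convert! hasDerivAt_gradV d P j l p x using 1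
  obtain ⟨e, rfl⟩ := Nat.exists_eq_add_of_le' hd
  have hconj (m : Fin r) : starRingEnd ℂ ((Pi.single i (Pi.single k c) : Fin r → Fin n → ℂ) m l) =
      if m = i then if k = l then starRingEnd ℂ c else 0 else 0 := by
    by_cases h : m = i
    · subst h
      simp [Pi.single_apply, eq_comm (a := k), apply_ite (starRingEnd ℂ)]
    · simp [h]
  simp only [hx, hv, hdot_single_left, hdot_single_right, sum_mul_single_single, hconj,
    Pi.zero_apply, ofReal_zero, zero_mul, zero_add, mul_add, add_mul, mul_ite, ite_mul, mul_zero,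
    Finset.sum_add_distrib, Finset.sum_ite_eq', Finset.mem_univ, if_true]
  rw [Cent, Dent]
  have h₁ : e + 2 - 1 = e + 1 := rfl
  have h₂ : e + 2 - 1 - 1 = e := rfl
  have h₃ : e + 2 - 2 = e := rfl
  rw [h₂, h₁, h₃]
  by_cases h : i = j
  · subst h
    simp only [if_true, mul_sub, Finset.mul_sum, mul_add, ← add_sub_assoc]
    congr 1
    · refine Eq.trans ?_ (add_right_comm _ _ _)
      congr 1
      · split_ifs <;> push_cast <;> ring
      · exact Finset.sum_congr rfl fun _ _ => by push_cast; ring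
    · ring
  · simp only [h, Ne.symm h, if_false, Finset.sum_const_zero]
    split_ifs <;> push_cast <;> ring

end PartialDerivatives

end Calculus

/-- the real Hessian of `f` is the block matrix
`H^R = [[A, Re(B)ᵀ, −Im(B)ᵀ], [Re B, Re(C+D), −Im(C+D)], [−Im B, Im(D−C), Re(D−C)]]`. -/
theorem hessian_formula {n r : ℕ} (d : ℕ) (hd : 2 ≤ d) (P : MvPolynomial (Fin n) ℂ)
    (hP : P.IsHomogeneous d) (p : Dom n r) :
    (∀ i j : Fin r,
      D2 (objective d P) p (eW i) (eW j) = ((hdot (vecOf p i) (vecOf p j)) ^ d).re) ∧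
    (∀ (i j : Fin r) (k : Fin n),
      D2 (objective d P) p (eRe i k) (eW j) = (Bent d P p i j k).re ∧
      D2 (objective d P) p (eW j) (eRe i k) = (Bent d P p i j k).re ∧
      D2 (objective d P) p (eIm i k) (eW j) = -(Bent d P p i j k).im ∧
      D2 (objective d P) p (eW j) (eIm i k) = -(Bent d P p i j k).im) ∧
    (∀ (i j : Fin r) (k l : Fin n),
      D2 (objective d P) p (eRe i k) (eRe j l) =
        (Cent d P p i k j l + Dent d p i k j l).re ∧
      D2 (objective d P) p (eRe i k) (eIm j l) =
        -(Cent d P p i k j l + Dent d p i k j l).im ∧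
      D2 (objective d P) p (eIm i k) (eRe j l) =
        (Dent d p i k j l - Cent d P p i k j l).im ∧
      D2 (objective d P) p (eIm i k) (eIm j l) =
        (Dent d p i k j l - Cent d P p i k j l).re) := by
  have hW (j : Fin r) : (fun q => fderiv ℝ (objective d P) q (eW j)) =
      fun q => (gradW d P j q).re := funext fun q => fderiv_objective_eW hP q j
  have hRe (j : Fin r) (l : Fin n) : (fun q => fderiv ℝ (objective d P) q (eRe j l)) =
      fun q => (gradV d P j l q).re := funext fun q => fderiv_objective_eRe hP q j l
  have hIm (j : Fin r) (l : Fin n) : (fun q => fderiv ℝ (objective d P) q (eIm j l)) =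
      fun q => -(gradV d P j l q).im := funext fun q => fderiv_objective_eIm hP q j l
  have dW (j : Fin r) := differentiable_gradW (n := n) d P j
  have dV (j : Fin r) (l : Fin n) := differentiable_gradV d P j l
  have hB (i j : Fin r) (k : Fin n) (c : ℂ) :
      (starRingEnd ℂ c * (d * p.1 i * hdot (vecOf p i) (vecOf p j) ^ (d - 1) * vecOf p j k) +
        c * if i = j then
          d * ∑ l, (p.1 l : ℂ) * hdot (vecOf p l) (vecOf p i) ^ (d - 1) *
            starRingEnd ℂ (vecOf p l k) - eval (vecOf p j) (pderiv k (conjPoly P))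
        else 0).re = (c * Bent d P p i j k).re := by
    rw [Bent, mul_add, add_re, add_re, ← conj_re (starRingEnd ℂ c * _)]
    simp only [map_mul, map_pow, conj_conj, conj_ofReal, map_natCast, hdot_conj_symm]
  refine ⟨fun i j => ?_, fun i j k => ⟨?_, ?_, ?_, ?_⟩, fun i j k l => ⟨?_, ?_, ?_, ?_⟩⟩
  · rw [D2, hW, fderiv_re_apply (dW j) (hasDerivAt_gradW_eW p i j)]
  · rw [D2, hW, fderiv_re_apply (dW j)
      (hasDerivAt_gradW_single p _ i j k 1 rfl (vecOf_eRe i k)), hB, one_mul]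
  · rw [D2, hRe, fderiv_re_apply (dV i k) (hasDerivAt_gradV_eW p i j k)]
  · rw [D2, hW, fderiv_re_apply (dW j)
      (hasDerivAt_gradW_single p _ i j k I rfl (vecOf_eIm i k)), hB, I_mul_re]
  · rw [D2, hIm, fderiv_neg_im_apply (dV i k) (hasDerivAt_gradV_eW p i j k)]
  · rw [D2, hRe, fderiv_re_apply (dV j l)
      (hasDerivAt_gradV_single hd p _ i j k l 1 rfl (vecOf_eRe i k))]
    simp [add_comm]
  · rw [D2, hIm, fderiv_neg_im_apply (dV j l)
      (hasDerivAt_gradV_single hd p _ i j k l 1 rfl (vecOf_eRe i k))]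
    simp [add_comm]
  · rw [D2, hRe, fderiv_re_apply (dV j l)
      (hasDerivAt_gradV_single hd p _ i j k l I rfl (vecOf_eIm i k))]
    simp [sub_eq_add_neg]
  · rw [D2, hIm, fderiv_neg_im_apply (dV j l)
      (hasDerivAt_gradV_single hd p _ i j k l I rfl (vecOf_eIm i k))]
    simp [sub_eq_add_neg, add_comm]

end
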